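/- For any complex parameters α_0,…,α_5 with α_0+α_1+α_2+α_3+α_4+α_5 = 1, there is no rational solution (f_0,…,f_5) of A_5(α_0,…,α_5) such that for some i ∈ {0,…,5}, f_i, f_{i+2}, f_{i+3}, f_{i+5} have a pole at t=∞ and f_{i+1}, f_{i+4} are holomorphic at t=∞. -/

import Mathlib

open Filter Topology Polynomial

noncomputable section

/-- Evaluation of a complex rational function at a point (junk value where the
reduced denominator vanishes). -/
def evalR (f : RatFunc ℂ) (t : ℂ) : ℂ := RatFunc.eval (RingHom.id ℂ) t f

/-- `f` is defined at `t`: the reduced denominator does not vanish at `t`. -/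
def DefinedAt (f : RatFunc ℂ) (t : ℂ) : Prop := Polynomial.eval t (RatFunc.denom f) ≠ 0

/-- `(f 0, …, f 5)` is a rational solution of the `A₅⁽¹⁾` Painlevé system `A₅(α)`:
the two constraints hold identically as rational functions, and the six ODEs hold at
every point where all six components are defined.  (Indices are taken in `Fin 6`,
i.e. modulo `6`.) -/
def IsA5Solution (α : Fin 6 → ℂ) (f : Fin 6 → RatFunc ℂ) : Prop :=
  f 0 + f 2 + f 4 = RatFunc.X ∧
  f 1 + f 3 + f 5 = RatFunc.X ∧
  ∀ t : ℂ, (∀ j : Fin 6, DefinedAt (f j) t) → ∀ i : Fin 6,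
    t / 2 * deriv (evalR (f i)) t =
      evalR (f i) t *
        (evalR (f (i + 1)) t * evalR (f (i + 2)) t
          + evalR (f (i + 1)) t * evalR (f (i + 4)) t
          + evalR (f (i + 3)) t * evalR (f (i + 4)) t
          - evalR (f (i + 2)) t * evalR (f (i + 3)) t
          - evalR (f (i + 2)) t * evalR (f (i + 5)) t
          - evalR (f (i + 4)) t * evalR (f (i + 5)) t)
      + (1 / 2 - α (i + 2) - α (i + 4)) * evalR (f i) t
      + α i * (evalR (f (i + 2)) t + evalR (f (i + 4)) t)

/-- `f` has a pole at `t = ∞`: `‖f t‖ → ∞` as `‖t‖ → ∞`. -/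
def PoleAtInfty (f : RatFunc ℂ) : Prop :=
  Tendsto (fun t => ‖evalR f t‖) (Bornology.cobounded ℂ) atTop

/-- `f` is holomorphic at `t = ∞`: `f` is bounded as `‖t‖ → ∞`. -/
def HoloAtInfty (f : RatFunc ℂ) : Prop :=
  IsBoundedUnder (· ≤ ·) (Bornology.cobounded ℂ) fun t => ‖evalR f t‖

/-- `f` has a pole at `c ∈ ℂ`: `‖f t‖ → ∞` as `t → c`. -/
def PoleAt (f : RatFunc ℂ) (c : ℂ) : Prop :=
  Tendsto (fun t => ‖evalR f t‖) (𝓝[≠] c) atTop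

/-- `f` is regular at `c ∈ ℂ`: it extends continuously to `c`. -/
def RegularAt (f : RatFunc ℂ) (c : ℂ) : Prop :=
  ∃ L : ℂ, Tendsto (fun t => evalR f t) (𝓝[≠] c) (𝓝 L)

/-- `z` is an integer. -/
def IsInt (z : ℂ) : Prop := ∃ n : ℤ, z = (n : ℂ)

/-- `z` is an even integer. -/
def IsEvenInt (z : ℂ) : Prop := ∃ n : ℤ, z = 2 * (n : ℂ)

/-- A tuple of rational functions has pole configuration of Type A at `t = ∞`. -/
def TypeA (f : Fin 6 → RatFunc ℂ) : Prop :=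
  ∃ i : Fin 6,
    (PoleAtInfty (f i) ∧ PoleAtInfty (f (i + 1)) ∧ HoloAtInfty (f (i + 2)) ∧
      HoloAtInfty (f (i + 3)) ∧ HoloAtInfty (f (i + 4)) ∧ HoloAtInfty (f (i + 5))) ∨
    (PoleAtInfty (f i) ∧ PoleAtInfty (f (i + 3)) ∧ HoloAtInfty (f (i + 1)) ∧
      HoloAtInfty (f (i + 2)) ∧ HoloAtInfty (f (i + 4)) ∧ HoloAtInfty (f (i + 5))) ∨
    (PoleAtInfty (f i) ∧ PoleAtInfty (f (i + 1)) ∧ PoleAtInfty (f (i + 2)) ∧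
      PoleAtInfty (f (i + 4)) ∧ HoloAtInfty (f (i + 3)) ∧ HoloAtInfty (f (i + 5)))

/-- A tuple of rational functions has pole configuration of Type B at `t = ∞`. -/
def TypeB (f : Fin 6 → RatFunc ℂ) : Prop :=
  ∃ i : Fin 6,
    PoleAtInfty (f i) ∧ PoleAtInfty (f (i + 1)) ∧ PoleAtInfty (f (i + 2)) ∧
    PoleAtInfty (f (i + 3)) ∧ HoloAtInfty (f (i + 4)) ∧ HoloAtInfty (f (i + 5))


theorem eventually_cobounded_eval_ne_zero {p : ℂ[X]} (hp : p ≠ 0) :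
    ∀ᶠ t in Bornology.cobounded ℂ, p.eval t ≠ 0 := by
  have hfin : {t : ℂ | p.eval t = 0}.Finite := Polynomial.finite_setOfPred_isRoot hp
  exact Bornology.isBounded_def.1 hfin.isBounded

theorem tendsto_eval_derivative_div_eval_cobounded (p : ℂ[X]) :
    Tendsto (fun t => p.derivative.eval t / p.eval t) (Bornology.cobounded ℂ) (𝓝 0) := by
  rcases eq_or_ne p 0 with rfl | hp
  · simp
  have hsum : Tendsto (fun t : ℂ => (p.roots.map fun z => 1 / (t - z)).sum)
      (Bornology.cobounded ℂ) (𝓝 (p.roots.map fun _ => (0 : ℂ)).sum) := by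
    refine tendsto_multiset_sum _ fun z _ => ?_
    simp only [one_div]
    exact tendsto_inv₀_cobounded.comp (tendsto_sub_const_cobounded z)
  rw [Multiset.sum_map_zero] at hsum
  refine hsum.congr' ?_
  filter_upwards [eventually_cobounded_eval_ne_zero hp] with t ht
  exact ((IsAlgClosed.splits p).eval_derivative_div_eval_of_ne_zero ht).symm

theorem eventually_definedAt (f : RatFunc ℂ) :
    ∀ᶠ t in Bornology.cobounded ℂ, DefinedAt f t :=
  eventually_cobounded_eval_ne_zero f.denom_ne_zero

theorem evalR_add {f g : RatFunc ℂ} {t : ℂ} (hf : DefinedAt f t) (hg : DefinedAt g t) :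
    evalR (f + g) t = evalR f t + evalR g t :=
  RatFunc.eval_add _ _ hf hg

theorem DefinedAt.add {f g : RatFunc ℂ} {t : ℂ} (hf : DefinedAt f t) (hg : DefinedAt g t) :
    DefinedAt (f + g) t := by
  intro h
  obtain ⟨r, hr⟩ := RatFunc.denom_add_dvd f g
  have := congrArg (Polynomial.eval t) hr
  rw [Polynomial.eval_mul, Polynomial.eval_mul, h, zero_mul] at this
  exact mul_ne_zero hf hg this

theorem evalR_add_add_eq {f g h : RatFunc ℂ} (hsum : f + g + h = RatFunc.X) {t : ℂ}
    (hf : DefinedAt f t) (hg : DefinedAt g t) (hh : DefinedAt h t) :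
    evalR f t + evalR g t + evalR h t = t := by
  rw [← evalR_add hf hg, ← evalR_add (hf.add hg) hh, hsum]
  exact RatFunc.eval_X _ _

/-- The logarithmic derivative of a nonzero rational function is bounded near infinity. -/
theorem eventually_norm_deriv_evalR_le {f : RatFunc ℂ} (hf : f ≠ 0) :
    ∀ᶠ t in Bornology.cobounded ℂ, ‖deriv (evalR f) t‖ ≤ ‖evalR f t‖ := by
  have hlim := (tendsto_eval_derivative_div_eval_cobounded f.num).sub
    (tendsto_eval_derivative_div_eval_cobounded f.denom)
  rw [sub_zero] at hlim
  have hle := hlim.norm.eventually_le_const (u := 1) (by simp)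
  filter_upwards [hle, eventually_definedAt f,
    eventually_cobounded_eval_ne_zero (RatFunc.num_ne_zero hf)] with t ht hd hn
  have hderiv : deriv (evalR f) t = evalR f t *
      (f.num.derivative.eval t / f.num.eval t - f.denom.derivative.eval t / f.denom.eval t) := by
    have h := (f.num.hasDerivAt t).fun_div (f.denom.hasDerivAt t) hd
    have hd' : f.denom.eval t ≠ 0 := hd
    rw [show evalR f = fun t => f.num.eval t / f.denom.eval t from rfl, h.deriv]
    field_simp
  rw [hderiv, norm_mul]
  exact mul_le_of_le_one_right (norm_nonneg _) ht

/-- Pointwise form of the estimate obtained by dividing the `i`-th equation by `f i`. -/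
theorem norm_le_of_equation {t a b c d e h D κ β : ℂ} {M : ℝ}
    (hodd : b + d + h = t) (heven : a + c + e = t)
    (hode : t / 2 * D = a * (b * c + b * e + d * e - c * d - c * h - e * h) + κ * a
      + β * (c + e))
    (hD : ‖D‖ ≤ ‖a‖) (ha : 1 ≤ ‖a‖) (ht : 1 ≤ ‖t‖) (he : ‖e‖ ≤ M) :
    ‖c * (t - 2 * b) + 2 * e * h‖ ≤ (M + 1 + ‖κ‖ + 2 * ‖β‖) * ‖t‖ := by
  have ha0 : a ≠ 0 := norm_pos_iff.1 (by linarith)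
  have key : c * (t - 2 * b) + 2 * e * h
      = e * t - t / 2 * (D / a) + κ + β * (t * a⁻¹) - β := by
    have hdiv : t / 2 * (D / a) = (b * c + b * e + d * e - c * d - c * h - e * h) + κ
        + β * (t * a⁻¹) - β := by
      rw [← mul_div_assoc, hode, show c + e = t - a by linear_combination heven]
      field_simp
      ring
    rw [hdiv]
    linear_combination (e - c) * hodd
  have hDa : ‖D / a‖ ≤ 1 := by
    rw [norm_div]
    exact div_le_one_of_le₀ hD (norm_nonneg _)
  have hainv : ‖a⁻¹‖ ≤ 1 := by
    rw [norm_inv]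
    exact inv_le_one_of_one_le₀ ha
  have h1 : ‖e * t‖ ≤ M * ‖t‖ := by
    rw [norm_mul]
    gcongr
  have h2 : ‖t / 2 * (D / a)‖ ≤ ‖t‖ := by
    rw [norm_mul, norm_div, Complex.norm_ofNat]
    nlinarith [norm_nonneg t, norm_nonneg (D / a)]
  have h3 : ‖β * (t * a⁻¹)‖ ≤ ‖β‖ * ‖t‖ := by
    rw [norm_mul, norm_mul]
    gcongr
    exact mul_le_of_le_one_right (norm_nonneg _) hainv
  have h4 := le_mul_of_one_le_right (norm_nonneg κ) ht
  have h5 := le_mul_of_one_le_right (norm_nonneg β) ht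
  rw [key]
  calc ‖e * t - t / 2 * (D / a) + κ + β * (t * a⁻¹) - β‖
      ≤ ‖e * t‖ + ‖t / 2 * (D / a)‖ + ‖κ‖ + ‖β * (t * a⁻¹)‖ + ‖β‖ := by
        refine (norm_sub_le _ _).trans ?_
        gcongr
        refine (norm_add_le _ _).trans ?_
        gcongr
        refine (norm_add_le _ _).trans ?_
        gcongr
        exact norm_sub_le _ _
    _ ≤ (M + 1 + ‖κ‖ + 2 * ‖β‖) * ‖t‖ := by linarith

theorem PoleAtInfty.ne_zero {f : RatFunc ℂ} (hf : PoleAtInfty f) : f ≠ 0 := by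
  rintro rfl
  obtain ⟨t, ht⟩ := (hf.eventually_ge_atTop 1).exists
  rw [show evalR 0 t = 0 from RatFunc.eval_zero _ _, norm_zero] at ht
  linarith

theorem IsA5Solution.sum_eq_X {α : Fin 6 → ℂ} {f : Fin 6 → RatFunc ℂ}
    (hf : IsA5Solution α f) (i : Fin 6) : f i + f (i + 2) + f (i + 4) = RatFunc.X := by
  obtain ⟨h0, h1, -⟩ := hf
  fin_cases i
  · exact h0
  · exact h1
  · exact (show f 2 + f 4 + f 0 = _ by rw [← h0]; ring)
  · exact (show f 3 + f 5 + f 1 = _ by rw [← h1]; ring)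
  · exact (show f 4 + f 0 + f 2 = _ by rw [← h0]; ring)
  · exact (show f 5 + f 1 + f 3 = _ by rw [← h1]; ring)

theorem HoloAtInfty.exists_bound {f : RatFunc ℂ} (hf : HoloAtInfty f) :
    ∃ M, ∀ᶠ t in Bornology.cobounded ℂ, ‖evalR f t‖ ≤ M :=
  hf

/-- If `f i` has a pole and `f (i + 4)` is holomorphic at infinity, then
`f (i + 2) * (t - 2 * f (i + 1)) + 2 * f (i + 4) * f (i + 5) = O(t)`. -/
theorem IsA5Solution.exists_eventually_norm_le {α : Fin 6 → ℂ} {f : Fin 6 → RatFunc ℂ}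
    (hf : IsA5Solution α f) (i : Fin 6) (hpole : PoleAtInfty (f i))
    (hholo : HoloAtInfty (f (i + 4))) :
    ∃ K : ℝ, ∀ᶠ t in Bornology.cobounded ℂ,
      ‖evalR (f (i + 2)) t * (t - 2 * evalR (f (i + 1)) t)
        + 2 * evalR (f (i + 4)) t * evalR (f (i + 5)) t‖ ≤ K * ‖t‖ := by
  obtain ⟨M, hM⟩ := hholo.exists_bound
  refine ⟨M + 1 + ‖1 / 2 - α (i + 2) - α (i + 4)‖ + 2 * ‖α i‖, ?_⟩
  filter_upwards [hM, hpole.eventually_ge_atTop 1, eventually_norm_deriv_evalR_le hpole.ne_zero,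
    tendsto_norm_cobounded_atTop.eventually_ge_atTop 1,
    eventually_all.2 fun j => eventually_definedAt (f j)] with t hMt ha hD ht hdef
  have hodd := hf.sum_eq_X (i + 1)
  rw [show i + 1 + 2 = i + 3 by grind, show i + 1 + 4 = i + 5 by grind] at hodd
  exact norm_le_of_equation (evalR_add_add_eq hodd (hdef _) (hdef _) (hdef _))
    (evalR_add_add_eq (hf.sum_eq_X i) (hdef _) (hdef _) (hdef _)) (hf.2.2 t hdef i) hD ha ht hMt

theorem mul_norm_le_of_norm_add_le {t b c e h : ℂ} {M K : ℝ} (hb : ‖b‖ ≤ M) (he : ‖e‖ ≤ M)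
    (hK : ‖c * (t - 2 * b) + 2 * e * h‖ ≤ K * ‖t‖) :
    ‖c‖ * ‖t‖ ≤ K * ‖t‖ + 2 * M * (‖c‖ + ‖h‖) := by
  calc ‖c‖ * ‖t‖ = ‖(c * (t - 2 * b) + 2 * e * h) + 2 * b * c - 2 * e * h‖ := by
        rw [← norm_mul]
        congr 1
        ring
    _ ≤ ‖c * (t - 2 * b) + 2 * e * h‖ + ‖2 * b * c‖ + ‖2 * e * h‖ :=
        (norm_sub_le _ _).trans (by gcongr; exact norm_add_le _ _)
    _ ≤ K * ‖t‖ + 2 * M * ‖c‖ + 2 * M * ‖h‖ := by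
        simp only [norm_mul, Complex.norm_ofNat]
        gcongr
    _ = K * ‖t‖ + 2 * M * (‖c‖ + ‖h‖) := by ring

/-- Nonexistence of rational solutions with the given pole configuration at `t = ∞`. -/
theorem stmt_10 (α : Fin 6 → ℂ)
    (hsum : α 0 + α 1 + α 2 + α 3 + α 4 + α 5 = 1) :
    ¬ ∃ (f : Fin 6 → RatFunc ℂ) (i : Fin 6), IsA5Solution α f ∧
      PoleAtInfty (f i) ∧
      PoleAtInfty (f (i + 2)) ∧
      PoleAtInfty (f (i + 3)) ∧
      PoleAtInfty (f (i + 5)) ∧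
      HoloAtInfty (f (i + 1)) ∧
      HoloAtInfty (f (i + 4)) := by
  rintro ⟨f, i, hf, h0, h2, h3, -, h1, h4⟩
  obtain ⟨K₁, hK₁⟩ := hf.exists_eventually_norm_le i h0 h4
  have h34 : i + 3 + 4 = i + 1 := by grind
  obtain ⟨K₂, hK₂⟩ := hf.exists_eventually_norm_le (i + 3) h3 (by rwa [h34])
  rw [h34, show i + 3 + 2 = i + 5 by grind, show i + 3 + 1 = i + 4 by grind,
    show i + 3 + 5 = i + 2 by grind] at hK₂
  obtain ⟨M₁, hM₁⟩ := h1.exists_bound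
  obtain ⟨M₂, hM₂⟩ := h4.exists_bound
  set M := max M₁ M₂
  obtain ⟨t, hK₁, hK₂, hM₁, hM₂, hc, ht, ht1⟩ := (hK₁.and <| hK₂.and <| hM₁.and <| hM₂.and <|
    (h2.eventually_ge_atTop (2 * (K₁ + K₂) + 1)).and <|
    (tendsto_norm_cobounded_atTop.eventually_ge_atTop (8 * M)).and <|
    tendsto_norm_cobounded_atTop.eventually_ge_atTop 1).exists
  replace hM₁ := hM₁.trans (le_max_left M₁ M₂)
  replace hM₂ := hM₂.trans (le_max_right M₁ M₂)
  have e₁ := mul_norm_le_of_norm_add_le hM₁ hM₂ hK₁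
  have e₂ := mul_norm_le_of_norm_add_le hM₂ hM₁ hK₂
  have hnn := add_nonneg (norm_nonneg (evalR (f (i + 2)) t)) (norm_nonneg (evalR (f (i + 5)) t))
  have e₃ := mul_le_mul_of_nonneg_right ht hnn
  have e₄ : ‖evalR (f (i + 2)) t‖ + ‖evalR (f (i + 5)) t‖ ≤ 2 * (K₁ + K₂) :=
    le_of_mul_le_mul_right (by linarith) (zero_lt_one.trans_le ht1)
  linarith [norm_nonneg (evalR (f (i + 5)) t)]
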